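/- arXiv:1902.08452 — 2 statements merged into one kernel-verified Lean document; each statement's English description precedes it below -/
import Mathlib

section
/- Let x, y ∈ ℝ^d, η > 0, and suppose ∇U is M-Lipschitz. Then the total variation distance between the Gaussian distributions N(x - (η²/2)∇U(x), η²I_d) and N(y - (η²/2)∇U(y), η²I_d) is at most ((1/2)η^{-1} + (1/4)ηM)·‖x − y‖₂. -/
open MeasureTheory ProbabilityTheory
open scoped ENNReal NNReal

/-- The standard Gaussian measure `N(0, I_d)` on `ℝ^d`. -/
noncomputable def stdGaussian (d : ℕ) : Measure (EuclideanSpace ℝ (Fin d)) :=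
  (Measure.pi fun _ : Fin d => gaussianReal 0 1).map (EuclideanSpace.equiv (Fin d) ℝ).symm

/-- The Gaussian measure `N(m, η² I_d)` on `ℝ^d`, realized as the pushforward
of the standard Gaussian by `v ↦ m + η • v`. -/
noncomputable def gaussianEuclidean {d : ℕ} (m : EuclideanSpace ℝ (Fin d)) (η : ℝ) :
    Measure (EuclideanSpace ℝ (Fin d)) :=
  (stdGaussian d).map (fun v => m + η • v)

/-- The total variation distance between two measures. -/
noncomputable def tvDist {E : Type*} [MeasurableSpace E] (μ ν : Measure E) : ℝ :=
  ⨆ A : Set E, |(μ A).toReal - (ν A).toReal|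

lemma abstract_tv {Ω : Type*} [MeasurableSpace Ω] (μ : Measure Ω) [IsProbabilityMeasure μ]
    (g : Ω → ℝ) (hg : Integrable g μ) (hg2 : Integrable (fun x => g x ^ 2) μ) 
    (h1 : ∫ x, g x ^ 2 ∂μ = 1) (hgp : ∀ x, 0 ≤ g x) (A : Set Ω) (hA : MeasurableSet A) :
    (μ.real A - ∫ x in A, g x ^ 2 ∂μ) ^ 2 ≤ 1 - (∫ x, g x ∂μ) ^ 2 := by
  set B := ∫ x, g x ∂μ with hB
  set t := μ.real A - ∫ x in A, g x ^ 2 ∂μ with ht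
  have key : ∀ c : ℝ, 0 ≤ (1 - B) * (c * c) + (-2 * t) * c + (1 + B) := by
    intro c
    have hint : Integrable (fun x => 1 - g x ^ 2) μ := (integrable_const 1).sub hg2
    have h0 : ∫ x, (1 - g x ^ 2) ∂μ = 0 := by
      rw [integral_sub (integrable_const 1) hg2, h1]; simp
    have hAe : ∫ x in A, (1 - g x ^ 2) ∂μ = t := by
      rw [integral_sub (integrable_const 1).integrableOn hg2.integrableOn]; simp [ht]
    have hAc : ∫ x in Aᶜ, (1 - g x ^ 2) ∂μ = -t := by
      have := integral_add_compl hA hint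
      linarith
    have e1 : ∀ s : ℝ, ∀ x, ((c * (1 - g x)) + s * (1 + g x)) ^ 2 
      = (c ^ 2 + s ^ 2 + (2 * (s ^ 2 - c ^ 2)) * g x + (c ^ 2 + s ^ 2) * g x ^ 2)
        + 2 * c * s * (1 - g x ^ 2) := by
      intro s x; ring
    have hJ : Integrable (fun x => c ^ 2 + 1 + (2 * (1 - c ^ 2)) * g x + (c ^ 2 + 1) * g x ^ 2) μ :=
      ((integrable_const _).add (hg.const_mul _)).add (hg2.const_mul _)
    have i1 : 0 ≤ ∫ x in A, ((c * (1 - g x)) + (-1) * (1 + g x)) ^ 2 ∂μ :=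
      integral_nonneg fun x => sq_nonneg _
    have i2 : 0 ≤ ∫ x in Aᶜ, ((c * (1 - g x)) + 1 * (1 + g x)) ^ 2 ∂μ :=
      integral_nonneg fun x => sq_nonneg _
    simp only [e1] at i1 i2
    norm_num at i1 i2
    rw [integral_add hJ.integrableOn (hint.const_mul _).integrableOn, integral_const_mul, hAc] at i2
    have i1' : 0 ≤ ∫ x in A, ((c ^ 2 + 1 + (2 * (1 - c ^ 2)) * g x + (c ^ 2 + 1) * g x ^ 2) + (-(2 * c)) * (1 - g x ^ 2)) ∂μ := by
      convert i1 using 3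
      ring
    rw [integral_add hJ.integrableOn (hint.const_mul _).integrableOn, integral_const_mul, hAe] at i1'
    have := integral_add_compl hA hJ
    have hT : ∫ x, (c ^ 2 + 1 + (2 * (1 - c ^ 2)) * g x + (c ^ 2 + 1) * g x ^ 2) ∂μ
        = c ^ 2 + 1 + (2 * (1 - c ^ 2)) * B + (c ^ 2 + 1) := by
      have hK : Integrable (fun x => c ^ 2 + 1 + (2 * (1 - c ^ 2)) * g x) μ :=
        (integrable_const _).add (hg.const_mul _)
      rw [integral_add hK (hg2.const_mul _),
        integral_add (integrable_const _) (hg.const_mul _), integral_const_mul, integral_const_mul, h1]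
      simp [hB]
    nlinarith
  have := discrim_le_zero key
  unfold discrim at this
  nlinarith

lemma gauss_density (h : ℝ) : gaussianReal h 1 = (gaussianReal 0 1).withDensity
    (fun x => ENNReal.ofReal (Real.exp (h / 2 * x - h ^ 2 / 4) ^ 2)) := by
  rw [gaussianReal_of_var_ne_zero _ one_ne_zero, gaussianReal_of_var_ne_zero _ one_ne_zero,
    ← withDensity_mul _ (by fun_prop) (by fun_prop)]
  congr 1
  ext x
  simp only [gaussianPDF, Pi.mul_apply]
  rw [← ENNReal.ofReal_mul (gaussianPDFReal_nonneg _ _ _)]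
  congr 1
  simp only [gaussianPDFReal]
  rw [← Real.exp_nat_mul, mul_assoc _ (Real.exp _), ← Real.exp_add]
  congr 2
  push_cast
  ring

lemma int_exp (t c : ℝ) : Integrable (fun x => Real.exp (t * x - c)) (gaussianReal 0 1) := by
  simp_rw [Real.exp_sub]
  exact (integrable_exp_mul_gaussianReal t).div_const _

lemma int_sq (h : ℝ) :
    Integrable (fun x => Real.exp (h / 2 * x - h ^ 2 / 4) ^ 2) (gaussianReal 0 1) := by
  convert int_exp h (h ^ 2 / 2) using 2 with x
  rw [← Real.exp_nat_mul]; congr 1; push_cast; ring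

lemma integral_half (h : ℝ) :
    ∫ x, Real.exp (h / 2 * x - h ^ 2 / 4) ∂(gaussianReal 0 1) = Real.exp (- h ^ 2 / 8) := by
  simp_rw [Real.exp_sub]
  rw [integral_div]
  have := congrFun (mgf_id_gaussianReal (μ := 0) (v := 1)) (h / 2)
  simp only [mgf, id] at this
  rw [this, ← Real.exp_sub]
  congr 1
  push_cast
  ring

lemma pi_density {d : ℕ} (h : Fin d → ℝ) : Measure.pi (fun i => gaussianReal (h i) 1) =
    (Measure.pi fun _ : Fin d => gaussianReal 0 1).withDensity
    (fun x => ENNReal.ofReal ((∏ i, Real.exp (h i / 2 * x i - h i ^ 2 / 4)) ^ 2)) := by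
  apply Measure.pi_eq
  intro s hs
  rw [withDensity_apply _ (MeasurableSet.univ_pi hs), Measure.restrict_pi_pi]
  simp_rw [← Finset.prod_pow]
  rw [← ofReal_integral_eq_lintegral_ofReal]
  · rw [integral_fintype_prod_eq_prod (f := fun i x => Real.exp (h i / 2 * x - h i ^ 2 / 4) ^ 2),
      ENNReal.ofReal_prod_of_nonneg (fun i _ => integral_nonneg fun x => sq_nonneg _)]
    refine Finset.prod_congr rfl fun i _ => ?_
    rw [gauss_density (h i), withDensity_apply _ (hs i), ← ofReal_integral_eq_lintegral_ofReal]
    · exact (int_sq (h i)).integrableOn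
    · exact Filter.Eventually.of_forall fun x => sq_nonneg _
  · exact Integrable.fintype_prod_dep (f := fun i x => Real.exp (h i / 2 * x - h i ^ 2 / 4) ^ 2)
      fun i => (int_sq (h i)).integrableOn
  · exact Filter.Eventually.of_forall fun x => Finset.prod_nonneg fun i _ => sq_nonneg _

lemma pi_tv {d : ℕ} (h : Fin d → ℝ) (A : Set (Fin d → ℝ)) (hA : MeasurableSet A) :
    ((Measure.pi fun _ : Fin d => gaussianReal 0 1).real A
      - (Measure.pi (fun i => gaussianReal (h i) 1)).real A) ^ 2 ≤ (∑ i, h i ^ 2) / 4 := by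
  set μ := (Measure.pi fun _ : Fin d => gaussianReal 0 1) with hμ
  set g : (Fin d → ℝ) → ℝ := fun x => ∏ i, Real.exp (h i / 2 * x i - h i ^ 2 / 4) with hg
  have hgi : Integrable g μ := 
    Integrable.fintype_prod_dep (f := fun i x => Real.exp (h i / 2 * x - h i ^ 2 / 4))
      fun i => int_exp _ _
  have hgi2 : Integrable (fun x => g x ^ 2) μ := by
    simp_rw [hg, ← Finset.prod_pow]
    exact Integrable.fintype_prod_dep (f := fun i x => Real.exp (h i / 2 * x - h i ^ 2 / 4) ^ 2)
      fun i => int_sq (h i)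
  have hreal : ∀ S, MeasurableSet S → 
      (Measure.pi (fun i => gaussianReal (h i) 1)).real S = ∫ x in S, g x ^ 2 ∂μ := by
    intro S hS
    rw [pi_density, measureReal_def, withDensity_apply _ hS,
      ← ofReal_integral_eq_lintegral_ofReal hgi2.integrableOn, ENNReal.toReal_ofReal]
    · exact integral_nonneg fun x => sq_nonneg _
    · exact Filter.Eventually.of_forall fun x => sq_nonneg _
  have h1 : ∫ x, g x ^ 2 ∂μ = 1 := by
    have := hreal Set.univ MeasurableSet.univ
    simpa using this.symm
  have hB : ∫ x, g x ∂μ = Real.exp (- (∑ i, h i ^ 2) / 8) := by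
    rw [hg, hμ, integral_fintype_prod_eq_prod (f := fun i x => Real.exp (h i / 2 * x - h i ^ 2 / 4))]
    simp_rw [integral_half]
    rw [← Real.exp_sum, ← Finset.sum_div, Finset.sum_neg_distrib]
  rw [hreal A hA]
  refine (abstract_tv μ g hgi hgi2 h1 (fun x => Finset.prod_nonneg fun i _ => (Real.exp_pos _).le) A hA).trans ?_
  rw [hB, ← Real.exp_nat_mul]
  have := Real.add_one_le_exp (((2 : ℕ) : ℝ) * (-(∑ i, h i ^ 2) / 8))
  push_cast at *
  linarith


lemma gaussianEuclidean_apply {d : ℕ} (m : EuclideanSpace ℝ (Fin d)) (η : ℝ) 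
    (A : Set (EuclideanSpace ℝ (Fin d))) (hA : MeasurableSet A) :
    gaussianEuclidean m η A = (Measure.pi fun _ : Fin d => gaussianReal 0 1)
      ((fun v => m + η • (EuclideanSpace.equiv (Fin d) ℝ).symm v) ⁻¹' A) := by
  have hm : Measurable (EuclideanSpace.equiv (Fin d) ℝ).symm :=
    (EuclideanSpace.equiv (Fin d) ℝ).symm.continuous.measurable
  rw [gaussianEuclidean, _root_.stdGaussian, Measure.map_map (by fun_prop) hm,
    Measure.map_apply ((by fun_prop : Measurable (fun v : EuclideanSpace ℝ (Fin d) => m + η • v)).comp hm) hA]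
  rfl

lemma gaussianEuclidean_apply_shift {d : ℕ} (m m' : EuclideanSpace ℝ (Fin d)) (η : ℝ) (hη : 0 < η)
    (A : Set (EuclideanSpace ℝ (Fin d))) (hA : MeasurableSet A) :
    gaussianEuclidean m' η A = (Measure.pi fun i : Fin d => gaussianReal (η⁻¹ * (m' i - m i)) 1)
      ((fun v => m + η • (EuclideanSpace.equiv (Fin d) ℝ).symm v) ⁻¹' A) := by
  have hm : Measurable (EuclideanSpace.equiv (Fin d) ℝ).symm :=
    (EuclideanSpace.equiv (Fin d) ℝ).symm.continuous.measurable
  have hm2 : Measurable (fun v => m + η • (EuclideanSpace.equiv (Fin d) ℝ).symm v) :=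
    (by fun_prop : Measurable (fun v : EuclideanSpace ℝ (Fin d) => m + η • v)).comp hm
  rw [gaussianEuclidean_apply _ _ _ hA]
  have e : (fun i : Fin d => gaussianReal (η⁻¹ * (m' i - m i)) 1)
     = fun i => (gaussianReal 0 1).map (fun x => x + η⁻¹ * (m' i - m i)) := by
    ext1 i
    rw [gaussianReal_map_add_const]; simp
  rw [e, ← Measure.pi_map_pi (fun i => by fun_prop), Measure.map_apply (by fun_prop) (hm2 hA)]
  congr 1
  ext v
  simp only [Set.mem_preimage]
  congr! 1
  ext i
  simp
  field_simp
  ring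

lemma tv_bound {d : ℕ} (m m' : EuclideanSpace ℝ (Fin d)) (η : ℝ) (hη : 0 < η) :
    tvDist (gaussianEuclidean m η) (gaussianEuclidean m' η) ≤ η⁻¹ * ‖m' - m‖ / 2 := by
  apply ciSup_le
  intro A
  obtain ⟨C, hC, hCm, h1, h2⟩ : ∃ C, A ⊆ C ∧ MeasurableSet C ∧ 
      gaussianEuclidean m η A = gaussianEuclidean m η C ∧
      gaussianEuclidean m' η A = gaussianEuclidean m' η C := by
    refine ⟨toMeasurable (gaussianEuclidean m η) A ∩ toMeasurable (gaussianEuclidean m' η) A,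
      Set.subset_inter (subset_toMeasurable _ _) (subset_toMeasurable _ _), 
      (measurableSet_toMeasurable _ _).inter (measurableSet_toMeasurable _ _), ?_, ?_⟩
    · apply le_antisymm
      · exact measure_mono (Set.subset_inter (subset_toMeasurable _ _) (subset_toMeasurable _ _))
      · exact (measure_mono Set.inter_subset_left).trans (measure_toMeasurable _).le
    · apply le_antisymm
      · exact measure_mono (Set.subset_inter (subset_toMeasurable _ _) (subset_toMeasurable _ _))
      · exact (measure_mono Set.inter_subset_right).trans (measure_toMeasurable _).le
  rw [h1, h2, gaussianEuclidean_apply _ _ _ hCm, gaussianEuclidean_apply_shift m m' η hη _ hCm]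
  have hm2 : Measurable (fun v => m + η • (EuclideanSpace.equiv (Fin d) ℝ).symm v) :=
    (by fun_prop : Measurable (fun v : EuclideanSpace ℝ (Fin d) => m + η • v)).comp
      (EuclideanSpace.equiv (Fin d) ℝ).symm.continuous.measurable
  have := pi_tv (fun i => η⁻¹ * (m' i - m i)) _ (hm2 hCm)
  apply abs_le_of_sq_le_sq _ (by positivity)
  refine this.trans (le_of_eq ?_)
  rw [div_pow, mul_pow, EuclideanSpace.real_norm_sq_eq]
  simp only [mul_pow, ← Finset.mul_sum, PiLp.sub_apply]
  norm_num

/-- **TV distance between the MALA proposal Gaussians.**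
If `∇U` is `M`-Lipschitz and `η > 0`, then the total variation distance between
`N(x - (η²/2)∇U(x), η² I_d)` and `N(y - (η²/2)∇U(y), η² I_d)` is at most
`((1/2)η⁻¹ + (1/4)ηM)‖x - y‖`. -/
theorem tv_gaussian_proposals
    {d : ℕ} (U : EuclideanSpace ℝ (Fin d) → ℝ)
    (hU : Differentiable ℝ U) (M : ℝ)
    (hlip : ∀ a b : EuclideanSpace ℝ (Fin d),
      ‖gradient U a - gradient U b‖ ≤ M * ‖a - b‖)
    (η : ℝ) (hη : 0 < η) (x y : EuclideanSpace ℝ (Fin d)) :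
    tvDist (gaussianEuclidean (x - (η ^ 2 / 2) • gradient U x) η)
        (gaussianEuclidean (y - (η ^ 2 / 2) • gradient U y) η)
      ≤ ((1 / 2) * η⁻¹ + (1 / 4) * η * M) * ‖x - y‖ := by
  refine (tv_bound _ _ η hη).trans ?_
  have h : ‖(y - (η ^ 2 / 2) • gradient U y) - (x - (η ^ 2 / 2) • gradient U x)‖
      ≤ ‖x - y‖ + η ^ 2 / 2 * (M * ‖x - y‖) := by
    have e : (y - (η ^ 2 / 2) • gradient U y) - (x - (η ^ 2 / 2) • gradient U x)
        = (y - x) + (η ^ 2 / 2) • (gradient U x - gradient U y) := by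
      rw [smul_sub]; abel
    rw [e]
    refine (norm_add_le _ _).trans ?_
    rw [norm_sub_rev y x, norm_smul, Real.norm_of_nonneg (by positivity)]
    gcongr
    exact hlip x y
  calc _ ≤ η⁻¹ * (‖x - y‖ + η ^ 2 / 2 * (M * ‖x - y‖)) / 2 := by gcongr
    _ = _ := by field_simp; ring
end

section
/- Consider a Markov chain on ℝ^d where from a point z one proposes γ_z = z + ηv − (η²/2)∇U(z) with v ∼ N(0, I_d), accepting with probability â_{z,v} ∈ [0,1], and let ρ_z denote the distribution of the next state started from z. Suppose the expected acceptance probabilities satisfy a_x ≥ 0.99 and a_y ≥ 0.99, and ‖x − y‖₂ ≤ (1/100)·((1/2)η^{-1} + (1/4)ηM)^{-1}. If ∇U is M-Lipschitz, then ‖ρ_x − ρ_y‖_TV < 3/100. -/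
open MeasureTheory ProbabilityTheory
open scoped ENNReal NNReal

lemma gauss_shift_one (h : ℝ) : gaussianReal h 1 =
    (gaussianReal 0 1).withDensity (fun x => ENNReal.ofReal (Real.exp (h * x - h ^ 2 / 2))) := by
  rw [gaussianReal_of_var_ne_zero _ one_ne_zero, gaussianReal_of_var_ne_zero _ one_ne_zero,
    ← withDensity_mul _ (measurable_gaussianPDF _ _) (by fun_prop)]
  congr 1
  ext x
  simp only [Pi.mul_apply, gaussianPDF]
  rw [← ENNReal.ofReal_mul (gaussianPDFReal_nonneg _ _ _)]
  congr 1
  simp only [gaussianPDFReal]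
  rw [mul_assoc _ (Real.exp _), ← Real.exp_add]
  congr 2
  simp
  ring

lemma gauss_exp_integrable (h c : ℝ) :
    Integrable (fun x => Real.exp (h * x - c)) (gaussianReal 0 1) := by
  simp_rw [Real.exp_sub]
  exact (integrable_exp_mul_gaussianReal h).div_const _

lemma gauss_exp_integral (h c : ℝ) :
    ∫ x, Real.exp (h * x - c) ∂(gaussianReal 0 1) = Real.exp (h ^ 2 / 2 - c) := by
  simp_rw [Real.exp_sub]
  rw [integral_div]
  congr 1
  have := congrFun (mgf_id_gaussianReal (μ := 0) (v := 1)) h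
  simpa [mgf] using this

lemma gauss_shift_pi {d : ℕ} (h : Fin d → ℝ) :
    Measure.pi (fun i => gaussianReal (h i) 1) =
    (Measure.pi (fun _ : Fin d => gaussianReal 0 1)).withDensity
      (fun x => ENNReal.ofReal (∏ i, Real.exp (h i * x i - h i ^ 2 / 2))) := by
  refine Measure.pi_eq fun s hs => ?_
  rw [withDensity_apply _ (MeasurableSet.univ_pi hs), Measure.restrict_pi_pi,
    ← ofReal_integral_eq_lintegral_ofReal
      (Integrable.fintype_prod (f := fun i x => Real.exp (h i * x - h i ^ 2 / 2))
        fun i => (gauss_exp_integrable _ _).restrict)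
      (Filter.Eventually.of_forall fun x => by positivity),
    integral_fintype_prod_eq_prod (f := fun i x => Real.exp (h i * x - h i ^ 2 / 2)),
    ENNReal.ofReal_prod_of_nonneg (fun i _ => by positivity)]
  refine Finset.prod_congr rfl fun i _ => ?_
  rw [gauss_shift_one (h i), withDensity_apply _ (hs i),
    ofReal_integral_eq_lintegral_ofReal (gauss_exp_integrable _ _).restrict
      (Filter.Eventually.of_forall fun x => by positivity)]

lemma gauss_shift_map {d : ℕ} (h : Fin d → ℝ) :
    (Measure.pi (fun _ : Fin d => gaussianReal 0 1)).map (fun x => x + h) =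
    Measure.pi (fun i => gaussianReal (h i) 1) := by
  have := Measure.pi_map_pi (μ := fun _ : Fin d => gaussianReal 0 1)
    (f := fun i x => x + h i) (fun i => by fun_prop)
  simp only [gaussianReal_map_add_const, zero_add] at this
  exact this

lemma hell {Ω : Type*} [MeasurableSpace Ω] (μ : Measure Ω) [IsProbabilityMeasure μ]
    (r : Ω → ℝ) (hr : ∀ x, 0 ≤ r x) (hi : Integrable r μ)
    (hi2 : Integrable (fun x => r x ^ 2) μ) (h1 : ∫ x, r x ^ 2 ∂μ = 1)
    (hb : 1 - 1 / 20000 ≤ ∫ x, r x ∂μ) (B : Set Ω) (hB : MeasurableSet B) :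
    |∫ x in B, r x ^ 2 ∂μ - μ.real B| ≤ 99999 / 10000000 := by
  have e1 : ∫ x in B, r x ^ 2 ∂μ - μ.real B = ∫ x in B, (r x ^ 2 - 1) ∂μ := by
    rw [integral_sub hi2.restrict (integrable_const _)]; simp
  have hI : Integrable (fun x => r x ^ 2 - 1) μ := hi2.sub (integrable_const _)
  have e2 := integral_add_compl hB hI
  have e3 : ∫ x, (r x ^ 2 - 1) ∂μ = 0 := by
    rw [integral_sub hi2 (integrable_const _)]; simp [h1]
  have e4 := integral_add_compl hB hI.abs
  have a1 := abs_integral_le_integral_abs (f := fun x => r x ^ 2 - 1) (μ := μ.restrict B)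
  have a2 := abs_integral_le_integral_abs (f := fun x => r x ^ 2 - 1) (μ := μ.restrict Bᶜ)
  have hI2 : Integrable (fun x => (100 + 1 / 400) * r x ^ 2 + (-200 + 1 / 200) * r x
      + (100 + 1 / 400)) μ :=
    ((hi2.const_mul _).add (hi.const_mul _)).add (integrable_const _)
  have a3 : ∫ x, |r x ^ 2 - 1| ∂μ ≤ ∫ x, ((100 + 1 / 400) * r x ^ 2 + (-200 + 1 / 200) * r x
      + (100 + 1 / 400)) ∂μ := by
    refine integral_mono hI.abs hI2 fun x => ?_
    simp only
    rw [abs_le]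
    constructor
    · nlinarith [sq_nonneg (200 * (r x - 1) + (r x + 1))]
    · nlinarith [sq_nonneg (200 * (r x - 1) - (r x + 1))]
  have hJ : Integrable (fun x => (100 + 1 / 400) * r x ^ 2 + (-200 + 1 / 200) * r x) μ :=
    (hi2.const_mul _).add (hi.const_mul _)
  rw [integral_add hJ (integrable_const _),
    integral_add (hi2.const_mul _) (hi.const_mul _), integral_const_mul, integral_const_mul, h1]
    at a3
  simp at a3
  rw [e1]
  have e5 : ∫ x in Bᶜ, (r x ^ 2 - 1) ∂μ = - ∫ x in B, (r x ^ 2 - 1) ∂μ := by linarith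
  rw [e5, abs_neg] at a2
  norm_num at a3 hb
  linarith

lemma pi_shift_tv {d : ℕ} (h : Fin d → ℝ) (hh : ∑ i, h i ^ 2 ≤ 4 / 10000)
    (B : Set (Fin d → ℝ)) (hB : MeasurableSet B) :
    |(Measure.pi (fun _ : Fin d => gaussianReal 0 1)).real ((fun x => x + h) ⁻¹' B)
      - (Measure.pi (fun _ : Fin d => gaussianReal 0 1)).real B| ≤ 99999 / 10000000 := by
  set μ := Measure.pi (fun _ : Fin d => gaussianReal 0 1) with hμ
  let r : (Fin d → ℝ) → ℝ := fun x => ∏ i, Real.exp (h i / 2 * x i - h i ^ 2 / 4)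
  have hr2 : ∀ x, r x ^ 2 = ∏ i, Real.exp (h i * x i - h i ^ 2 / 2) := by
    intro x
    simp only [r]
    rw [← Finset.prod_pow]
    refine Finset.prod_congr rfl fun i _ => ?_
    rw [← Real.exp_nat_mul]
    congr 1; push_cast; ring
  have hi : Integrable r μ := Integrable.fintype_prod
    (f := fun i x => Real.exp (h i / 2 * x - h i ^ 2 / 4)) fun i => gauss_exp_integrable _ _
  have hi2 : Integrable (fun x => r x ^ 2) μ := by
    simp_rw [hr2]
    exact Integrable.fintype_prod
      (f := fun i x => Real.exp (h i * x - h i ^ 2 / 2)) fun i => gauss_exp_integrable _ _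
  have h1 : ∫ x, r x ^ 2 ∂μ = 1 := by
    simp_rw [hr2]
    rw [hμ, integral_fintype_prod_eq_prod (f := fun i x => Real.exp (h i * x - h i ^ 2 / 2))]
    simp [gauss_exp_integral]
  have hb : 1 - 1 / 20000 ≤ ∫ x, r x ∂μ := by
    simp only [r]
    rw [hμ, integral_fintype_prod_eq_prod (f := fun i x => Real.exp (h i / 2 * x - h i ^ 2 / 4))]
    simp only [gauss_exp_integral]
    rw [← Real.exp_sum]
    have : ∑ i, ((h i / 2) ^ 2 / 2 - h i ^ 2 / 4) = - (∑ i, h i ^ 2) / 8 := by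
      rw [neg_div, Finset.sum_div, ← Finset.sum_neg_distrib]
      exact Finset.sum_congr rfl fun i _ => by ring
    rw [this]
    have := Real.add_one_le_exp (- (∑ i, h i ^ 2) / 8)
    linarith
  have key := hell μ r (fun x => by positivity) hi hi2 h1 hb B hB
  have e : μ.real ((fun x => x + h) ⁻¹' B) = ∫ x in B, r x ^ 2 ∂μ := by
    rw [← map_measureReal_apply (by fun_prop) hB, hμ, gauss_shift_map, gauss_shift_pi,
      Measure.real, withDensity_apply _ hB, ← hμ]
    simp_rw [← hr2]
    rw [integral_eq_lintegral_of_nonneg_ae (Filter.Eventually.of_forall fun x => by positivity)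
      hi2.restrict.aestronglyMeasurable]
  rwa [e]

instance stdGaussian_prob (d : ℕ) : IsProbabilityMeasure (_root_.stdGaussian d) := by
  unfold _root_.stdGaussian
  exact Measure.isProbabilityMeasure_map (by fun_prop)

lemma std_shift_tv {d : ℕ} (h : EuclideanSpace ℝ (Fin d)) (hh : ‖h‖ ≤ 1 / 50)
    (B : Set (EuclideanSpace ℝ (Fin d))) (hB : MeasurableSet B) :
    |(_root_.stdGaussian d).real ((fun x => x + h) ⁻¹' B)
      - (_root_.stdGaussian d).real B| ≤ 99999 / 10000000 := by
  have hm : Measurable (EuclideanSpace.equiv (Fin d) ℝ).symm := by fun_prop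
  have hB' : MeasurableSet ((fun x => x + h) ⁻¹' B) := hB.preimage (by fun_prop)
  unfold _root_.stdGaussian
  rw [map_measureReal_apply hm hB, map_measureReal_apply hm hB']
  have hs : ∑ i, h i ^ 2 ≤ 4 / 10000 := by
    have := EuclideanSpace.real_norm_sq_eq h
    rw [← this]
    nlinarith [norm_nonneg h]
  exact pi_shift_tv (fun i => h i) hs _ (hB.preimage hm)

lemma accept_close {E : Type*} [MeasurableSpace E] (G : Measure E) [IsProbabilityMeasure G]
    (f : E → ℝ) (hf : ∀ v, f v ∈ Set.Icc (0 : ℝ) 1) (hfa : 0.99 ≤ ∫ v, f v ∂G)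
    (g : E → E) (hg : Measurable g) (z : E) (A : Set E) (hA : MeasurableSet A) :
    |(∫⁻ v, (ENNReal.ofReal (f v) * A.indicator (fun _ => 1) (g v)
        + ENNReal.ofReal (1 - f v) * A.indicator (fun _ => 1) z) ∂G).toReal - G.real (g ⁻¹' A)|
      ≤ 1 / 100 := by
  have hfi : Integrable f G := by
    by_contra hc
    rw [integral_undef hc] at hfa
    norm_num at hfa
  have hm1 : AEMeasurable (fun v => ENNReal.ofReal (1 - f v)) G :=
    (aemeasurable_const.sub hfi.aemeasurable).ennreal_ofReal
  have hrej : ∫⁻ v, ENNReal.ofReal (1 - f v) ∂G ≤ ENNReal.ofReal (1 / 100) := by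
    have hI : Integrable (fun v => 1 - f v) G := (integrable_const _).sub hfi
    rw [← ofReal_integral_eq_lintegral_ofReal hI
      (Filter.Eventually.of_forall fun v => by have := (hf v).2; simpa using this)]
    apply ENNReal.ofReal_le_ofReal
    rw [integral_sub (integrable_const _) hfi]
    simp
    norm_num at hfa ⊢
    linarith
  have hP : ∫⁻ v, A.indicator (fun _ => (1 : ℝ≥0∞)) (g v) ∂G = G (g ⁻¹' A) := by
    rw [← lintegral_indicator_one (hg hA)]
    rfl
  have hsum : ∀ v, ENNReal.ofReal (f v) + ENNReal.ofReal (1 - f v) = 1 := fun v => by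
    rw [← ENNReal.ofReal_add (hf v).1 (by linarith [(hf v).2])]; simp
  have hle1 : ∀ v, ENNReal.ofReal (f v) ≤ 1 := fun v => by simpa using (hf v).2
  set R := ∫⁻ v, (ENNReal.ofReal (f v) * A.indicator (fun _ => 1) (g v)
        + ENNReal.ofReal (1 - f v) * A.indicator (fun _ => 1) z) ∂G with hR
  have u1 : R ≤ G (g ⁻¹' A) + ENNReal.ofReal (1 / 100) := by
    calc R ≤ ∫⁻ v, (A.indicator (fun _ => 1) (g v) + ENNReal.ofReal (1 - f v)) ∂G := by
          refine lintegral_mono fun v => add_le_add ?_ ?_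
          · exact mul_le_of_le_one_left' (hle1 v)
          · refine mul_le_of_le_one_right' ?_
            exact Set.indicator_le_self' (fun _ _ => zero_le) z
      _ = G (g ⁻¹' A) + ∫⁻ v, ENNReal.ofReal (1 - f v) ∂G := by
          rw [lintegral_add_right' _ hm1, hP]
      _ ≤ _ := by gcongr
  have u2 : G (g ⁻¹' A) ≤ R + ENNReal.ofReal (1 / 100) := by
    calc G (g ⁻¹' A) = ∫⁻ v, A.indicator (fun _ => (1 : ℝ≥0∞)) (g v) ∂G := hP.symm
      _ ≤ ∫⁻ v, ((ENNReal.ofReal (f v) * A.indicator (fun _ => 1) (g v)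
        + ENNReal.ofReal (1 - f v) * A.indicator (fun _ => 1) z)
          + ENNReal.ofReal (1 - f v)) ∂G := by
          refine lintegral_mono fun v => ?_
          by_cases hv : g v ∈ A
          · simp only [Set.indicator_of_mem hv, mul_one]
            calc (1 : ℝ≥0∞) = ENNReal.ofReal (f v) + ENNReal.ofReal (1 - f v) := (hsum v).symm
              _ ≤ _ := by gcongr; exact le_self_add
          · simp [Set.indicator_of_notMem hv]
      _ = R + ∫⁻ v, ENNReal.ofReal (1 - f v) ∂G := by
          rw [lintegral_add_right' _ hm1]
      _ ≤ _ := by gcongr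
  have hRt : R ≠ ∞ := ne_top_of_le_ne_top (by finiteness) u1
  have v1 := ENNReal.toReal_mono (by finiteness) u1
  have v2 := ENNReal.toReal_mono (by finiteness) u2
  rw [ENNReal.toReal_add (by finiteness) (by finiteness), ENNReal.toReal_ofReal (by norm_num)]
    at v1 v2
  rw [Measure.real, abs_le]
  constructor <;> linarith

/-- **Closeness of the one-step transition distributions of MALA-type chains.**
The chain proposes `γ z v = z + η v − (η²/2)∇U(z)` with `v ∼ N(0, I_d)`, accepts with
probability `â z v ∈ [0,1]`, and otherwise stays at `z`; `ρ z` is the one-step transition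
distribution and `a z = E_v[â z v]` the mean acceptance probability.  If `∇U` is
`M`-Lipschitz, `a x, a y ≥ 0.99` and `‖x − y‖ ≤ (1/100)((1/2)η⁻¹ + (1/4)ηM)⁻¹`
then `‖ρ x − ρ y‖_TV < 3/100`. -/
theorem tv_transition_close
    {d : ℕ} (U : EuclideanSpace ℝ (Fin d) → ℝ)
    (hU : Differentiable ℝ U) (M : ℝ)
    (hlip : ∀ a b : EuclideanSpace ℝ (Fin d),
      ‖gradient U a - gradient U b‖ ≤ M * ‖a - b‖)
    (η : ℝ) (hη : 0 < η)
    (ahat : EuclideanSpace ℝ (Fin d) → EuclideanSpace ℝ (Fin d) → ℝ)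
    (hahat : ∀ z v, ahat z v ∈ Set.Icc (0 : ℝ) 1)
    (γ : EuclideanSpace ℝ (Fin d) → EuclideanSpace ℝ (Fin d) → EuclideanSpace ℝ (Fin d))
    (hγ : ∀ z v, γ z v = z + η • v - (η ^ 2 / 2) • gradient U z)
    (ρ : EuclideanSpace ℝ (Fin d) → Measure (EuclideanSpace ℝ (Fin d)))
    (hρ : ∀ z (A : Set (EuclideanSpace ℝ (Fin d))), MeasurableSet A →
      ρ z A = ∫⁻ v, (ENNReal.ofReal (ahat z v) * A.indicator (fun _ => 1) (γ z v)
        + ENNReal.ofReal (1 - ahat z v) * A.indicator (fun _ => 1) z) ∂(stdGaussian d))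
    (a : EuclideanSpace ℝ (Fin d) → ℝ)
    (ha : ∀ z, a z = ∫ v, ahat z v ∂(stdGaussian d))
    (x y : EuclideanSpace ℝ (Fin d))
    (hax : 0.99 ≤ a x) (hay : 0.99 ≤ a y)
    (hxy : ‖x - y‖ ≤ (1 / 100) * ((1 / 2) * η⁻¹ + (1 / 4) * η * M)⁻¹) :
    tvDist (ρ x) (ρ y) < 3 / 100 := by
  set G := _root_.stdGaussian d with hG
  -- strict bound for the proposals, with a uniform constant
  have hshift : ‖(η⁻¹ • ((y - (η ^ 2 / 2) • gradient U y) - (x - (η ^ 2 / 2) • gradient U x)) :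
      EuclideanSpace ℝ (Fin d))‖ ≤ 1 / 50 := by
    by_cases hxy0 : x = y
    · subst hxy0; simp
    have hn : 0 < ‖x - y‖ := norm_pos_iff.mpr (sub_ne_zero.mpr hxy0)
    have hM : 0 ≤ M := by
      by_contra hc
      have := hlip x y
      have h0 := norm_nonneg (gradient U x - gradient U y)
      nlinarith [mul_pos (neg_pos.mpr (not_le.mp hc)) hn]
    have hc : 0 < (1 / 2) * η⁻¹ + (1 / 4) * η * M := by positivity
    have h1 : ‖x - y‖ * ((1 / 2) * η⁻¹ + (1 / 4) * η * M) ≤ 1 / 100 := by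
      rwa [← div_eq_mul_inv, le_div_iff₀ hc] at hxy
    have e : (y - (η ^ 2 / 2) • gradient U y) - (x - (η ^ 2 / 2) • gradient U x)
        = (η ^ 2 / 2) • (gradient U x - gradient U y) - (x - y) := by
      rw [smul_sub]; abel
    rw [e, norm_smul, Real.norm_of_nonneg (by positivity)]
    have h2 : ‖(η ^ 2 / 2) • (gradient U x - gradient U y) - (x - y)‖
        ≤ (η ^ 2 / 2) * (M * ‖x - y‖) + ‖x - y‖ := by
      refine (norm_sub_le _ _).trans ?_
      rw [norm_smul, Real.norm_of_nonneg (by positivity)]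
      gcongr
      exact hlip x y
    calc η⁻¹ * ‖(η ^ 2 / 2) • (gradient U x - gradient U y) - (x - y)‖
        ≤ η⁻¹ * ((η ^ 2 / 2) * (M * ‖x - y‖) + ‖x - y‖) := by gcongr
      _ = 2 * (‖x - y‖ * ((1 / 2) * η⁻¹ + (1 / 4) * η * M)) := by field_simp; ring
      _ ≤ 1 / 50 := by linarith
  set h := (η⁻¹ • ((y - (η ^ 2 / 2) • gradient U y) - (x - (η ^ 2 / 2) • gradient U x)) :
      EuclideanSpace ℝ (Fin d)) with hh
  have hγm : ∀ z, Measurable (γ z) := fun z => by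
    have : γ z = fun v => z + η • v - (η ^ 2 / 2) • gradient U z := funext (hγ z)
    rw [this]; fun_prop
  have hγs : ∀ v, γ y v = γ x (v + h) := by
    intro v
    rw [hγ, hγ, hh, smul_add, smul_inv_smul₀ hη.ne']
    abel
  have hmeas : ∀ A, MeasurableSet A →
      |(ρ x A).toReal - (ρ y A).toReal| ≤ 299999 / 10000000 := by
    intro A hA
    have k1 := accept_close G (ahat x) (hahat x) (by rw [← ha]; exact hax) (γ x) (hγm x) x A hA
    have k2 := accept_close G (ahat y) (hahat y) (by rw [← ha]; exact hay) (γ y) (hγm y) y A hA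
    rw [← hρ x A hA] at k1
    rw [← hρ y A hA] at k2
    have k3 := std_shift_tv h hshift (γ x ⁻¹' A) (hγm x hA)
    have e : (fun v => v + h) ⁻¹' (γ x ⁻¹' A) = γ y ⁻¹' A := by
      ext v; simp [hγs]
    rw [e, ← hG] at k3
    rw [abs_le] at *
    constructor <;> linarith [k1.1, k1.2, k2.1, k2.2, k3.1, k3.2]
  refine lt_of_le_of_lt (b := 299999 / 10000000) ?_ (by norm_num)
  refine ciSup_le fun A => ?_
  have hB := hmeas (toMeasurable (ρ x) A ∩ toMeasurable (ρ y) A)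
    ((measurableSet_toMeasurable _ _).inter (measurableSet_toMeasurable _ _))
  have hsub : A ⊆ toMeasurable (ρ x) A ∩ toMeasurable (ρ y) A :=
    Set.subset_inter (subset_toMeasurable _ _) (subset_toMeasurable _ _)
  have e1 : ρ x (toMeasurable (ρ x) A ∩ toMeasurable (ρ y) A) = ρ x A :=
    le_antisymm ((measure_mono Set.inter_subset_left).trans (measure_toMeasurable _).le)
      (measure_mono hsub)
  have e2 : ρ y (toMeasurable (ρ x) A ∩ toMeasurable (ρ y) A) = ρ y A :=
    le_antisymm ((measure_mono Set.inter_subset_right).trans (measure_toMeasurable _).le)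
      (measure_mono hsub)
  rwa [e1, e2] at hB
end
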